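/- arXiv:2404.19392 — 2 statements merged into one kernel-verified Lean document; each statement's English description precedes it below -/
import Mathlib

section
/- Let 1 ≤ r ≤ n and let X, Y ∈ ℝ^{n×r} both satisfy XᵀX = YᵀY = I_r. Then ‖X·sym(Xᵀ(X − Y))‖ ≤ (1/2)·‖X − Y‖², where sym(M) := (M + Mᵀ)/2 and ‖·‖ denotes the Frobenius norm. (The matrix X·sym(Xᵀ(X − Y)) is the orthogonal projection of X − Y onto the normal space to the Stiefel manifold at X.) -/
open Matrix

/-- Frobenius norm of a real matrix: `‖A‖ = √(trace (Aᵀ * A))`. -/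
noncomputable def frobNorm {m n : ℕ} (A : Matrix (Fin m) (Fin n) ℝ) : ℝ :=
  Real.sqrt (Matrix.trace (Aᵀ * A))

/-- Symmetric part of a square matrix: `sym(M) = (M + Mᵀ)/2`. -/
noncomputable def symPart {r : ℕ} (M : Matrix (Fin r) (Fin r) ℝ) : Matrix (Fin r) (Fin r) ℝ :=
  (2⁻¹ : ℝ) • (M + Mᵀ)

theorem frobNorm_eq_norm {m n : ℕ} (A : Matrix (Fin m) (Fin n) ℝ) :
    frobNorm A = @norm _ Matrix.frobeniusNormedAddCommGroup.toNorm A := by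
  rw [Matrix.frobenius_norm_def, frobNorm, Real.sqrt_eq_rpow, Finset.sum_comm]
  simp [Matrix.trace, Matrix.mul_apply, sq]

theorem frobNorm_mul_le {l m n : ℕ} (A : Matrix (Fin l) (Fin m) ℝ)
    (B : Matrix (Fin m) (Fin n) ℝ) : frobNorm (A * B) ≤ frobNorm A * frobNorm B := by
  simpa only [frobNorm_eq_norm] using Matrix.frobenius_norm_mul A B

theorem frobNorm_transpose {m n : ℕ} (A : Matrix (Fin m) (Fin n) ℝ) :
    frobNorm Aᵀ = frobNorm A := by
  rw [frobNorm, frobNorm, transpose_transpose, trace_mul_comm]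

theorem frobNorm_smul {m n : ℕ} {c : ℝ} (hc : 0 ≤ c) (A : Matrix (Fin m) (Fin n) ℝ) :
    frobNorm (c • A) = c * frobNorm A := by
  simp only [frobNorm, transpose_smul, Matrix.smul_mul, Matrix.mul_smul, trace_smul, smul_eq_mul]
  rw [← mul_assoc, Real.sqrt_mul (mul_self_nonneg c), Real.sqrt_mul_self hc]

/-- Left multiplication by a matrix with orthonormal columns preserves the Frobenius norm. -/
theorem frobNorm_mul_of_transpose_mul_self_eq_one {n r k : ℕ} {X : Matrix (Fin n) (Fin r) ℝ}
    (hX : Xᵀ * X = 1) (M : Matrix (Fin r) (Fin k) ℝ) : frobNorm (X * M) = frobNorm M := by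
  rw [frobNorm, frobNorm, transpose_mul, Matrix.mul_assoc, ← Matrix.mul_assoc Xᵀ, hX,
    Matrix.one_mul]

theorem symPart_transpose_mul_sub {n r : ℕ} {X Y : Matrix (Fin n) (Fin r) ℝ}
    (hX : Xᵀ * X = 1) (hY : Yᵀ * Y = 1) :
    symPart (Xᵀ * (X - Y)) = (2⁻¹ : ℝ) • ((X - Y)ᵀ * (X - Y)) := by
  simp only [symPart, transpose_mul, transpose_sub, transpose_transpose, Matrix.mul_sub,
    Matrix.sub_mul, hX, hY, transpose_one]
  congr 1
  abel

/-- Lemma 4.9 on the Stiefel manifold (with explicit constant `L₄ = 1/2`): for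
`X, Y ∈ St(r,n)`, the normal-space projection of `X − Y` at `X` satisfies
`‖X·sym(Xᵀ(X − Y))‖ ≤ (1/2)·‖X − Y‖²`. -/
theorem normal_projection_diff_bound {n r : ℕ} (hr : 1 ≤ r) (hrn : r ≤ n)
    (X Y : Matrix (Fin n) (Fin r) ℝ) (hX : Xᵀ * X = 1) (hY : Yᵀ * Y = 1) :
    frobNorm (X * symPart (Xᵀ * (X - Y))) ≤ (1 / 2) * frobNorm (X - Y) ^ 2 := by
  rw [frobNorm_mul_of_transpose_mul_self_eq_one hX, symPart_transpose_mul_sub hX hY,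
    frobNorm_smul (by norm_num), one_div, sq]
  gcongr
  simpa only [frobNorm_transpose] using frobNorm_mul_le (X - Y)ᵀ (X - Y)
end

section
/- Let 1 ≤ r ≤ n and δ > 0. Let X ∈ ℝ^{n×r} satisfy XᵀX = I_r, let V ∈ ℝ^{n×r} satisfy XᵀV + VᵀX = 0, and let S ∈ ℝ^{r×r} be symmetric with S − (δ−1)·I_r positive semidefinite. If Z ∈ ℝ^{n×r} satisfies ZᵀZ = I_r and ‖(X + V + XS) − Z‖ ≤ ‖(X + V + XS) − Z′‖ for every Z′ with Z′ᵀZ′ = I_r (i.e., Z is a projection of X + V + XS onto the Stiefel manifold), then ‖Z − X‖ ≤ (2/δ)·‖V‖, where ‖·‖ denotes the Frobenius norm. -/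
open Matrix

theorem trace_transpose_mul_eq_sum {m n : ℕ} (A B : Matrix (Fin m) (Fin n) ℝ) :
    (Aᵀ * B).trace = ∑ p : Fin n × Fin m, A p.2 p.1 * B p.2 p.1 := by
  simp [Matrix.trace, Matrix.mul_apply, Fintype.sum_prod_type]

theorem trace_transpose_mul_self_nonneg {m n : ℕ} (A : Matrix (Fin m) (Fin n) ℝ) :
    0 ≤ (Aᵀ * A).trace := by
  rw [trace_transpose_mul_eq_sum]
  exact Finset.sum_nonneg fun p _ => mul_self_nonneg _

theorem frobNorm_sq {m n : ℕ} (A : Matrix (Fin m) (Fin n) ℝ) :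
    frobNorm A ^ 2 = (Aᵀ * A).trace :=
  Real.sq_sqrt (trace_transpose_mul_self_nonneg A)

/-- The Cauchy–Schwarz inequality for the Frobenius inner product. -/
theorem trace_transpose_mul_le_frobNorm_mul {m n : ℕ} (A B : Matrix (Fin m) (Fin n) ℝ) :
    (Aᵀ * B).trace ≤ frobNorm A * frobNorm B := by
  simp only [frobNorm, trace_transpose_mul_eq_sum, ← pow_two]
  exact Real.sum_mul_le_sqrt_mul_sqrt _ _ _

/-- Among matrices with orthonormal columns, being closer to `Y` means having a larger
Frobenius inner product with `Y`. -/
theorem trace_transpose_mul_sub_nonneg {m n : ℕ} {X Y Z : Matrix (Fin m) (Fin n) ℝ}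
    (hX : Xᵀ * X = 1) (hZ : Zᵀ * Z = 1) (h : frobNorm (Y - Z) ≤ frobNorm (Y - X)) :
    0 ≤ (Yᵀ * (Z - X)).trace := by
  have h_sq := pow_le_pow_left₀ (Real.sqrt_nonneg _) h 2
  have hYX : (Xᵀ * Y).trace = (Yᵀ * X).trace := by
    rw [← Matrix.trace_transpose, Matrix.transpose_mul, Matrix.transpose_transpose]
  have hYZ : (Zᵀ * Y).trace = (Yᵀ * Z).trace := by
    rw [← Matrix.trace_transpose, Matrix.transpose_mul, Matrix.transpose_transpose]
  change frobNorm (Y - Z) ^ 2 ≤ frobNorm (Y - X) ^ 2 at h_sq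
  simp only [frobNorm_sq, Matrix.transpose_sub, Matrix.sub_mul, Matrix.mul_sub,
    Matrix.trace_sub, hX, hZ, hYX, hYZ] at h_sq ⊢
  linarith

/-- For `X`, `Z` with orthonormal columns, `-(Z - X)ᵀ (Z - X) / 2` is the symmetric part of
`Xᵀ (Z - X)`, so both have the same trace against a symmetric matrix. -/
theorem trace_symm_mul_transpose_mul_sub {m n : ℕ} {X Z : Matrix (Fin m) (Fin n) ℝ}
    {H : Matrix (Fin n) (Fin n) ℝ} (hX : Xᵀ * X = 1) (hZ : Zᵀ * Z = 1) (hH : H.IsSymm) :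
    (H * (Xᵀ * (Z - X))).trace = -((H * ((Z - X)ᵀ * (Z - X))).trace / 2) := by
  have hHZX : (H * (Zᵀ * X)).trace = (H * (Xᵀ * Z)).trace := by
    rw [← Matrix.trace_transpose, Matrix.transpose_mul, Matrix.transpose_mul,
      Matrix.transpose_transpose, hH.eq, Matrix.trace_mul_comm]
  simp only [Matrix.transpose_sub, Matrix.sub_mul, Matrix.mul_sub, Matrix.trace_sub,
    hX, hZ, hHZX]
  ring

theorem trace_posSemidef_mul_transpose_mul_self_nonneg {m n : ℕ}
    {P : Matrix (Fin n) (Fin n) ℝ} (hP : P.PosSemidef) (D : Matrix (Fin m) (Fin n) ℝ) :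
    0 ≤ (P * (Dᵀ * D)).trace := by
  have h := (hP.mul_mul_conjTranspose_same D).trace_nonneg
  rwa [Matrix.conjTranspose_eq_transpose_of_trivial, Matrix.mul_assoc, Matrix.trace_mul_comm,
    Matrix.mul_assoc] at h

/-- Example 4.5: on the Stiefel manifold, `2/δ` is a valid first-order
boundedness constant: if `X ∈ St(r,n)`, `V` is tangent at `X`, `S` is symmetric
with `S ≽ (δ−1)·I`, and `Z` is a projection of `X + V + XS` onto `St(r,n)`,
then `‖Z − X‖ ≤ (2/δ)·‖V‖`. -/
theorem stiefel_first_order_boundedness {n r : ℕ} (hr : 1 ≤ r) (hrn : r ≤ n)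
    (δ : ℝ) (hδ : 0 < δ)
    (X V : Matrix (Fin n) (Fin r) ℝ) (S : Matrix (Fin r) (Fin r) ℝ)
    (hX : Xᵀ * X = 1) (hV : Xᵀ * V + Vᵀ * X = 0) (hS : S.IsSymm)
    (hSδ : (S - (δ - 1) • (1 : Matrix (Fin r) (Fin r) ℝ)).PosSemidef)
    (Z : Matrix (Fin n) (Fin r) ℝ) (hZ : Zᵀ * Z = 1)
    (hproj : ∀ Z' : Matrix (Fin n) (Fin r) ℝ, Z'ᵀ * Z' = 1 →
      frobNorm ((X + V + X * S) - Z) ≤ frobNorm ((X + V + X * S) - Z')) :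
    frobNorm (Z - X) ≤ (2 / δ) * frobNorm V := by
  have h_opt := trace_transpose_mul_sub_nonneg hX hZ (hproj X hX)
  have h_normal := trace_symm_mul_transpose_mul_sub hX hZ (Matrix.isSymm_one.add hS)
  have h_psd := trace_posSemidef_mul_transpose_mul_self_nonneg hSδ (Z - X)
  have h_cs := trace_transpose_mul_le_frobNorm_mul V (Z - X)
  have h_split : ((X + V + X * S)ᵀ * (Z - X)).trace
      = (Vᵀ * (Z - X)).trace + ((1 + S) * (Xᵀ * (Z - X))).trace := by
    simp only [Matrix.transpose_add, Matrix.transpose_mul, hS.eq, Matrix.add_mul,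
      Matrix.trace_add, Matrix.one_mul, Matrix.mul_assoc]
    ring
  rw [h_split, h_normal, Matrix.add_mul, Matrix.trace_add, Matrix.one_mul] at h_opt
  rw [Matrix.sub_mul, Matrix.trace_sub, Matrix.smul_mul, Matrix.trace_smul, Matrix.one_mul,
    smul_eq_mul] at h_psd
  rw [← frobNorm_sq] at h_opt h_psd
  have h_nonneg : 0 ≤ frobNorm (Z - X) := Real.sqrt_nonneg _
  have hV_nonneg : 0 ≤ frobNorm V := Real.sqrt_nonneg _
  rw [div_mul_eq_mul_div, le_div_iff₀ hδ]
  rcases h_nonneg.eq_or_lt with h_zero | h_pos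
  · rw [← h_zero]
    linarith
  · refine le_of_mul_le_mul_right ?_ h_pos
    linarith
end
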